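/- Let R be a commutative ring, let u_1,...,u_n be a d-sequence in R, and let U = (u_1,...,u_n) be the ideal they generate. Then for every t ≥ 1 and every i = 1,...,n, one has the equality of colon ideals ((u_1,...,u_{i-1}) + U^t) : u_i = ((u_1,...,u_{i-1}) : u_i) + U^{t-1} (where for i = 1 the ideal (u_1,...,u_{i-1}) is the zero ideal). -/

import Mathlib

/-- `u 0, …, u (n-1)` is a *d-sequence*: writing `J i` for the ideal generated by
the first `i` terms of the sequence, one requires
`(J i : u i * u j) = (J i : u j)` for all `i ≤ j < n`. -/
def IsDSequence {R : Type*} [CommRing R] {n : ℕ} (u : Fin n → R) : Prop :=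
  ∀ i j : Fin n, (i : ℕ) ≤ (j : ℕ) →
    Submodule.colon (Ideal.span (u '' {k : Fin n | (k : ℕ) < (i : ℕ)}))
        (Ideal.span {u i * u j}) =
      Submodule.colon (Ideal.span (u '' {k : Fin n | (k : ℕ) < (i : ℕ)}))
        (Ideal.span {u j})

/-- The ideal generated by the terms of `u` with index less than `k`. -/
def initialIdeal {R : Type*} [CommRing R] {n : ℕ} (u : Fin n → R) (k : ℕ) : Ideal R :=
  Ideal.span (u '' {j : Fin n | (j : ℕ) < k})

section

variable {R : Type*} [CommRing R] {n : ℕ} {u : Fin n → R}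

theorem mem_colon_span_singleton_iff {I : Ideal R} {a x : R} :
    x ∈ Submodule.colon I (Ideal.span {a} : Set R) ↔ x * a ∈ I := by
  rw [Submodule.mem_colon]
  refine ⟨fun h => h a (Ideal.mem_span_singleton_self a), fun h p hp => ?_⟩
  obtain ⟨c, rfl⟩ := Ideal.mem_span_singleton'.1 hp
  have := I.mul_mem_left c h
  rwa [smul_eq_mul, mul_left_comm]

theorem initialIdeal_succ (i : Fin n) :
    initialIdeal u (i + 1) = initialIdeal u i ⊔ Ideal.span {u i} := by
  have h : {j : Fin n | (j : ℕ) < i + 1} = {j : Fin n | (j : ℕ) < i} ∪ {i} := by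
    ext j
    simp only [Set.mem_ofPred_eq, Set.mem_union, Set.mem_singleton_iff, Fin.ext_iff]
    omega
  rw [initialIdeal, initialIdeal, h, Set.image_union, Set.image_singleton, Ideal.span_union]

theorem initialIdeal_length : initialIdeal u n = Ideal.span (Set.range u) := by
  simp [initialIdeal]

theorem initialIdeal_mono : Monotone (initialIdeal u) := fun _ _ h =>
  Ideal.span_mono (Set.image_mono fun _ hj => lt_of_lt_of_le hj h)

theorem initialIdeal_le_span_range (k : ℕ) :
    initialIdeal u k ≤ Ideal.span (Set.range u) :=
  Ideal.span_mono (Set.image_subset_range _ _)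

theorem IsDSequence.mul_mem_iff (hu : IsDSequence u) {i j : Fin n} (hij : (i : ℕ) ≤ j) {x : R} :
    x * (u i * u j) ∈ initialIdeal u i ↔ x * u j ∈ initialIdeal u i := by
  have h := SetLike.ext_iff.1 (hu i j hij) x
  rwa [mem_colon_span_singleton_iff, mem_colon_span_singleton_iff] at h

/-- For a d-sequence, `((u 0, …, u (i-1)) : u i) ∩ (u 0, …, u (n-1)) = (u 0, …, u (i-1))`. -/
theorem IsDSequence.mem_initialIdeal_of_mul_mem (hu : IsDSequence u) (i : Fin n) {x : R}
    (hx : x * u i ∈ initialIdeal u i) (hxU : x ∈ Ideal.span (Set.range u)) :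
    x ∈ initialIdeal u i := by
  rw [← initialIdeal_length] at hxU
  refine Nat.decreasingInduction' (P := fun k => x ∈ initialIdeal u k)
    (fun k hk hik hxk => ?_) i.2.le hxU
  obtain ⟨y, hy, z, hz, rfl⟩ := Submodule.mem_sup.1 (initialIdeal_succ (u := u) ⟨k, hk⟩ ▸ hxk)
  obtain ⟨a, rfl⟩ := Ideal.mem_span_singleton'.1 hz
  have hxj : (y + a * u ⟨k, hk⟩) * u ⟨k, hk⟩ ∈ initialIdeal u i := by
    refine (hu.mul_mem_iff (j := ⟨k, hk⟩) hik).1 ?_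
    rw [← mul_assoc]
    exact Ideal.mul_mem_right _ _ hx
  refine add_mem hy ((hu.mul_mem_iff (i := ⟨k, hk⟩) (j := ⟨k, hk⟩) le_rfl).1 ?_)
  have h := sub_mem (initialIdeal_mono hik hxj) (Ideal.mul_mem_right (u ⟨k, hk⟩) _ hy)
  convert h using 1
  ring

/-- An element of `(u 0, …, u i) * I` is the sum of an element of `(u 0, …, u (i-1)) * I` and
a multiple of `u i` by an element of `I`. -/
theorem exists_of_mem_initialIdeal_succ_mul {I : Ideal R} {i : Fin n} {x : R}
    (hx : x ∈ initialIdeal u (i + 1) * I) :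
    ∃ y ∈ initialIdeal u i * I, ∃ a ∈ I, y + u i * a = x := by
  rw [initialIdeal_succ, Ideal.sup_mul] at hx
  obtain ⟨y, hy, z, hz, rfl⟩ := Submodule.mem_sup.1 hx
  obtain ⟨a, ha, rfl⟩ := Ideal.mem_span_singleton_mul.1 hz
  exact ⟨y, hy, a, ha, rfl⟩

theorem IsDSequence.initialIdeal_inf_pow_le (hu : IsDSequence u) (t : ℕ) {k : ℕ} (hk : k ≤ n) :
    initialIdeal u k ⊓ Ideal.span (Set.range u) ^ (t + 1) ≤
      initialIdeal u k * Ideal.span (Set.range u) ^ t := by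
  induction t generalizing k with
  | zero => simp
  | succ t ih =>
    refine Nat.decreasingInduction' (P := fun k => initialIdeal u k ⊓ _ ≤ initialIdeal u k * _)
      (fun k hkn _ ihk => ?_) hk ?_
    · rintro x ⟨hxk, hxU⟩
      obtain ⟨y, hy, a, ha, rfl⟩ := exists_of_mem_initialIdeal_succ_mul (i := ⟨k, hkn⟩)
        (ihk ⟨initialIdeal_mono k.le_succ hxk, hxU⟩)
      have hak : a ∈ initialIdeal u k := by
        refine hu.mem_initialIdeal_of_mul_mem ⟨k, hkn⟩ ?_ (Ideal.pow_le_self t.succ_ne_zero ha)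
        rw [mul_comm]
        exact (Submodule.add_mem_iff_right _ (Ideal.mul_le_left hy)).1 hxk
      refine add_mem hy ?_
      rw [pow_succ, ← mul_assoc, mul_comm (u _)]
      exact Ideal.mul_mem_mul (ih hkn.le ⟨hak, ha⟩) (Ideal.subset_span ⟨_, rfl⟩)
    · rw [initialIdeal_length, ← pow_succ']
      exact inf_le_right

end

/-- **Observation 2.4.** If `u 1, …, u n` is a d-sequence in a commutative ring `R`
generating the ideal `U`, then for every `t ≥ 1` and every `i`,
`((u 1, …, u (i-1)) + U^t) : u i = ((u 1, …, u (i-1)) : u i) + U^(t-1)`. -/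
theorem colon_power_of_dSequence {R : Type*} [CommRing R] {n : ℕ} (u : Fin n → R)
    (hu : IsDSequence u) (U : Ideal R) (hU : U = Ideal.span (Set.range u))
    (t : ℕ) (ht : 1 ≤ t) (i : Fin n) :
    Submodule.colon (Ideal.span (u '' {k : Fin n | (k : ℕ) < (i : ℕ)}) + U ^ t)
        (Ideal.span {u i}) =
      Submodule.colon (Ideal.span (u '' {k : Fin n | (k : ℕ) < (i : ℕ)}))
        (Ideal.span {u i}) + U ^ (t - 1) := by
  subst hU
  obtain ⟨t, rfl⟩ := Nat.exists_eq_add_of_le' ht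
  rw [Nat.add_sub_cancel]
  change Submodule.colon (initialIdeal u i + _) _ = Submodule.colon (initialIdeal u i) _ + _
  ext r
  rw [mem_colon_span_singleton_iff, Submodule.add_eq_sup, Submodule.add_eq_sup]
  constructor
  · intro h
    obtain ⟨y, hy, z, hz, hyz⟩ := Submodule.mem_sup.1 h
    have hzi : z ∈ initialIdeal u (i + 1) := by
      rw [initialIdeal_succ, eq_sub_of_add_eq' hyz]
      exact sub_mem
        (Ideal.mem_sup_right (Ideal.mul_mem_left _ r (Ideal.mem_span_singleton_self _)))
        (Ideal.mem_sup_left hy)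
    obtain ⟨w, hw, a, ha, rfl⟩ := exists_of_mem_initialIdeal_succ_mul
      (hu.initialIdeal_inf_pow_le t i.2 ⟨hzi, hz⟩)
    refine Submodule.mem_sup.2 ⟨r - a, ?_, a, ha, sub_add_cancel r a⟩
    rw [mem_colon_span_singleton_iff]
    convert add_mem hy (Ideal.mul_le_left hw) using 1
    linear_combination -hyz
  · intro h
    obtain ⟨y, hy, a, ha, rfl⟩ := Submodule.mem_sup.1 h
    rw [add_mul]
    refine Submodule.add_mem_sup (mem_colon_span_singleton_iff.1 hy) ?_
    rw [pow_succ]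
    exact Ideal.mul_mem_mul ha (Ideal.subset_span ⟨i, rfl⟩)
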